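/- arXiv:2211.09444 — 2 statements merged into one kernel-verified Lean document; each statement's English description precedes it below -/
import Mathlib

section
/- Let r ≥ 2 and let M = (M^m)_{m≥0} be a mould with M^0 = 0. Then M satisfies Ecalle's senary relation at depth r if and only if the identity ũ(M)^{r+1}(x_1,…,x_{r+1}) + coll^{r+1}_{2,3}(ũ(M))(x_1,…,x_{r+1}) = ũ(M)^{r+1}(x_2,…,x_{r+1},x_1) + coll^{r+1}_{1,2}(ũ(M))(x_1,…,x_{r+1}) holds in ℚ(x_1,…,x_{r+1}). -/
open MvPolynomial
open scoped TensorProduct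

open MvPolynomial

/-- A mould: a family `M = (M^m)_{m ≥ 0}` with `M^m ∈ ℚ[x_1,…,x_m]`. -/
abbrev Mould : Type := (m : ℕ) → MvPolynomial (Fin m) ℚ

/-- Evaluation of the depth-`m` component of a mould at a vector `v`. -/
noncomputable def mEval {K : Type} [CommRing K] (f : ℚ →+* K) (M : Mould) {m : ℕ}
    (v : Fin m → K) : K :=
  MvPolynomial.eval₂ f v (M m)

/-- The rational function field `ℚ(x_1,…,x_n)`. -/
abbrev FF (n : ℕ) : Type := FractionRing (MvPolynomial (Fin n) ℚ)

/-- The variable `x_i` as an element of `ℚ(x_1,…,x_n)`. -/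
noncomputable def xv {n : ℕ} (i : Fin n) : FF n :=
  algebraMap (MvPolynomial (Fin n) ℚ) (FF n) (X i)

/-- Ecalle's senary relation at depth `r = s+1`, as an identity in `ℚ(y_1,…,y_r)`:
`M^r(y_1,…,y_r) + (M^{r-1}(y_1,…,y_{r-2},y_{r-1}+y_r) - M^{r-1}(y_1,…,y_{r-1}))/y_r
 = M^r(-y_1-⋯-y_r, y_1,…,y_{r-1})
   + (M^{r-1}(-y_2-⋯-y_r, y_2,…,y_{r-1}) - M^{r-1}(y_1,…,y_{r-1}))/(y_1+⋯+y_r)`. -/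
noncomputable def SenaryAt (M : Mould) (s : ℕ) : Prop :=
  mEval (Rat.castHom (FF (s+1))) M (fun i : Fin (s+1) => xv i)
    + (mEval (Rat.castHom (FF (s+1))) M (fun i : Fin s =>
          if i.val = s - 1 then xv (⟨s-1, by omega⟩ : Fin (s+1)) + xv (Fin.last s)
          else xv i.castSucc)
       - mEval (Rat.castHom (FF (s+1))) M (fun i : Fin s => xv i.castSucc)) / xv (Fin.last s)
  = mEval (Rat.castHom (FF (s+1))) M (fun i : Fin (s+1) =>
        if i.val = 0 then -(∑ j : Fin (s+1), xv j)
        else xv (⟨i.val - 1, by have := i.isLt; omega⟩ : Fin (s+1)))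
    + (mEval (Rat.castHom (FF (s+1))) M (fun i : Fin s =>
          if i.val = 0 then -(∑ j : Fin s, xv j.succ) else xv i.castSucc)
       - mEval (Rat.castHom (FF (s+1))) M (fun i : Fin s => xv i.castSucc))
      / (∑ j : Fin (s+1), xv j)
/-- Evaluation of `ũ(M)^{m+1}` (where `ũ = t̃ ∘ swap`):
`ũ(M)^{m+1}(v_1,…,v_{m+1}) = M^m(v_{m+1}-v_1, v_m-v_{m+1}, v_{m-1}-v_m, …, v_2-v_3)`. -/
noncomputable def uEval {K : Type} [CommRing K] (f : ℚ →+* K) (M : Mould) {m : ℕ}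
    (v : Fin (m+1) → K) : K :=
  mEval f M (fun j : Fin m =>
    if h : j.val = 0 then v (Fin.last m) - v 0
    else v ⟨m - j.val, by omega⟩ - v ⟨m - j.val + 1, by have := j.isLt; omega⟩)

/-- `coll^{t+2}_{i,i+1}` (with `1`-indexed `i = k+1`) applied to `N = ũ(M)`,
evaluated at `v = (x_1,…,x_{t+2})`:
`(N^{t+1}(x_1,…,x_i,x_{i+2},…) - N^{t+1}(x_1,…,x_{i-1},x_{i+1},x_{i+2},…))/(x_i - x_{i+1})`. -/
noncomputable def collUEval {K : Type} [Field K] (f : ℚ →+* K) (M : Mould) {t : ℕ}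
    (k : Fin (t+1)) (v : Fin (t+2) → K) : K :=
  (uEval f M (fun j : Fin (t+1) => v (Fin.succAbove k.succ j))
    - uEval f M (fun j : Fin (t+1) => v (Fin.succAbove k.castSucc j)))
    / (v k.castSucc - v k.succ)

section DifferenceVector

variable {K : Type} [CommRing K]

/-- The arguments `(v_{m+1}-v_1, v_m-v_{m+1}, …, v_2-v_3)` at which `uEval` evaluates the mould. -/
def uArgs {m : ℕ} (v : Fin (m + 1) → K) (j : Fin m) : K :=
  if _h : j.val = 0 then v (Fin.last m) - v 0
  else v ⟨m - j.val, by omega⟩ - v ⟨m - j.val + 1, by have := j.isLt; omega⟩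

theorem uEval_eq_mEval_uArgs (f : ℚ →+* K) (M : Mould) {m : ℕ} (v : Fin (m + 1) → K) :
    uEval f M v = mEval f M (uArgs v) := rfl

theorem map_uArgs {L : Type} [CommRing L] (g : K →+* L) {m : ℕ} (v : Fin (m + 1) → K)
    (j : Fin m) : g (uArgs v j) = uArgs (fun i => g (v i)) j := by
  unfold uArgs
  split_ifs <;> simp

theorem uArgs_zero {m : ℕ} (v : Fin (m + 2) → K) : uArgs v 0 = v (Fin.last _) - v 0 := by
  simp [uArgs]

theorem uArgs_succ {m : ℕ} (v : Fin (m + 2) → K) (j : Fin m) :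
    uArgs v j.succ = v j.succ.castSucc.rev - v j.castSucc.castSucc.rev := by
  rw [uArgs, dif_neg (by simp)]
  congr 2 <;> ext <;> simp
  omega

theorem sum_fin_sub {n : ℕ} (w : Fin (n + 1) → K) :
    ∑ j : Fin n, (w j.succ - w j.castSucc) = w (Fin.last n) - w 0 := by
  induction n with
  | zero => simp
  | succ n ih =>
    rw [Fin.sum_univ_castSucc]
    have := ih fun i => w i.castSucc
    simp only [← Fin.succ_castSucc] at this
    rw [this]
    simp

theorem sum_uArgs_succ {m : ℕ} (v : Fin (m + 2) → K) :
    ∑ j : Fin m, uArgs v j.succ = v 1 - v (Fin.last _) := by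
  have := sum_fin_sub fun i : Fin (m + 1) => v i.castSucc.rev
  simp only [uArgs_succ, this]
  congr 2
  ext; simp

theorem sum_uArgs {m : ℕ} (v : Fin (m + 2) → K) : ∑ j, uArgs v j = v 1 - v 0 := by
  rw [Fin.sum_univ_succ, sum_uArgs_succ, uArgs_zero]
  ring

/-- The vector `v` with `v_1 = 0` and `uArgs v = y`, given by partial sums of `y`. -/
def partialSums {m : ℕ} (y : Fin m → K) (i : Fin (m + 1)) : K :=
  if i.val = 0 then 0 else ∑ j : Fin m, if j.val + i.val ≤ m then y j else 0

theorem uArgs_partialSums {m : ℕ} (y : Fin m → K) : uArgs (partialSums y) = y := by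
  funext j
  have hj := j.isLt
  unfold uArgs partialSums
  by_cases h : j.val = 0
  · rw [dif_pos h, if_neg (by simp; omega), if_pos (by simp), sub_zero, Finset.sum_eq_single j]
    · simp [h]
    · intro b _ hb
      have := Fin.val_ne_of_ne hb
      rw [if_neg (by simp; omega)]
    · simp
  · simp only
    rw [dif_neg h, if_neg (by omega), if_neg (by omega), ← Finset.sum_sub_distrib,
      Finset.sum_eq_single j]
    · rw [if_pos (by omega), if_neg (by omega), sub_zero]
    · intro b _ hb
      have := Fin.val_ne_of_ne hb
      by_cases hbj : b.val ≤ j.val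
      · rw [if_pos (by omega), if_pos (by omega), sub_self]
      · rw [if_neg (by omega), if_neg (by omega), sub_self]
    · simp

end DifferenceVector

theorem aeval_uArgs_X_injective (m : ℕ) :
    Function.Injective
      (aeval (uArgs X) : MvPolynomial (Fin m) ℚ →ₐ[ℚ] MvPolynomial (Fin (m + 1)) ℚ) := by
  have h : (aeval (partialSums X)).comp (aeval (uArgs X)) =
      AlgHom.id ℚ (MvPolynomial (Fin m) ℚ) := by
    ext1 i
    have := map_uArgs (aeval (partialSums X) :
      MvPolynomial (Fin (m + 1)) ℚ →ₐ[ℚ] MvPolynomial (Fin m) ℚ).toRingHom X i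
    simpa [uArgs_partialSums] using this
  exact Function.LeftInverse.injective (g := aeval (partialSums X)) fun p =>
    DFunLike.congr_fun h p

/-- The inclusion `ℚ[x_1,…,x_n] → ℚ(x_1,…,x_n)`. -/
noncomputable def polyToFF (n : ℕ) : MvPolynomial (Fin n) ℚ →+* FF n :=
  algebraMap (MvPolynomial (Fin n) ℚ) (FF n)

theorem polyToFF_injective (n : ℕ) : Function.Injective (polyToFF n) :=
  IsFractionRing.injective (MvPolynomial (Fin n) ℚ) (FF n)

/-- The embedding `ℚ(y_1,…,y_m) → ℚ(x_1,…,x_{m+1})` sending `y` to `uArgs x`. -/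
noncomputable def uArgsHom (m : ℕ) : FF m →+* FF (m + 1) :=
  IsFractionRing.lift (A := MvPolynomial (Fin m) ℚ)
    (g := (polyToFF (m + 1)).comp
      (aeval (uArgs X) : MvPolynomial (Fin m) ℚ →ₐ[ℚ] MvPolynomial (Fin (m + 1)) ℚ).toRingHom)
    (by
      rw [RingHom.coe_comp]
      exact (polyToFF_injective (m + 1)).comp (aeval_uArgs_X_injective m))

theorem uArgsHom_xv {m : ℕ} (i : Fin m) : uArgsHom m (xv i) = uArgs xv i := by
  rw [uArgsHom, xv, IsFractionRing.lift_algebraMap]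
  simpa using! map_uArgs (polyToFF (m + 1)) X i

theorem map_mEval {K L : Type} [CommRing K] [CommRing L] (g : K →+* L) (f : ℚ →+* K)
    (f' : ℚ →+* L) (M : Mould) {m : ℕ} (v : Fin m → K) :
    g (mEval f M v) = mEval f' M (fun i => g (v i)) := by
  rw [mEval, hom_eval₂, Subsingleton.elim (g.comp f) f']
  rfl

/-- For `r = s+1 ≥ 2` and a mould `M` with `M^0 = 0`, the senary
relation at depth `r` is equivalent to the identity
`ũ(M)^{r+1}(x_1,…,x_{r+1}) + coll^{r+1}_{2,3}(ũ(M))(x_1,…,x_{r+1})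
 = ũ(M)^{r+1}(x_2,…,x_{r+1},x_1) + coll^{r+1}_{1,2}(ũ(M))(x_1,…,x_{r+1})`
in `ℚ(x_1,…,x_{r+1})`. -/
theorem senary_iff_coll (M : Mould) (h0 : M 0 = 0) (s : ℕ) (hs : 1 ≤ s) :
    SenaryAt M s ↔
      uEval (Rat.castHom (FF (s+2))) M (fun i : Fin (s+2) => xv i)
          + collUEval (Rat.castHom (FF (s+2))) M ⟨1, by omega⟩ (fun i : Fin (s+2) => xv i)
        = uEval (Rat.castHom (FF (s+2))) M
            (fun j : Fin (s+2) =>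
              xv (⟨(j.val + 1) % (s+2), Nat.mod_lt _ (by omega)⟩ : Fin (s+2)))
          + collUEval (Rat.castHom (FF (s+2))) M ⟨0, by omega⟩
              (fun i : Fin (s+2) => xv i) := by
  rw [SenaryAt, ← (uArgsHom (s + 1)).injective.eq_iff]
  simp only [map_add, map_sub, map_div₀, map_mEval _ _ (Rat.castHom (FF (s + 2))), map_neg,
    map_sum, uArgsHom_xv, apply_ite (uArgsHom (s + 1)), sum_uArgs, sum_uArgs_succ,
    uEval_eq_mEval_uArgs, collUEval]
  obtain ⟨t, rfl⟩ : ∃ t, s = t + 1 := ⟨s - 1, by omega⟩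
  obtain ⟨z, hz⟩ : ∃ z : ℕ → FF (t + 1 + 2), ∀ i, xv i = z i.val :=
    ⟨fun n => if h : n < t + 1 + 2 then xv ⟨n, h⟩ else 0, fun i => by simp⟩
  have hlast : uArgs xv (Fin.last (t + 1)) = (xv 1 - xv ⟨2, by omega⟩ : FF (t + 1 + 2)) := by
    rw [← Fin.succ_last, uArgs_succ]
    congr 2 <;> ext <;> simp
  have hmerge : (fun i : Fin (t + 1) =>
      if i.val = t + 1 - 1 then uArgs xv (⟨t + 1 - 1, by omega⟩ : Fin (t + 1 + 1))
        + uArgs xv (Fin.last (t + 1)) else uArgs xv i.castSucc) =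
      uArgs fun j : Fin (t + 1 + 1) =>
        (xv (Fin.succAbove (Fin.succ ⟨1, by omega⟩) j) : FF (t + 1 + 2)) := by
    funext i
    have hi := i.isLt
    simp only [uArgs, hz, Fin.succAbove, Fin.lt_def, apply_ite Fin.val]
    have h2 : 2 % (t + 1 + 1 + 1) = 2 := Nat.mod_eq_of_lt (by omega)
    simp [h2, -Fin.val_eq_zero_iff]
    grind
  have hinit : (fun i : Fin (t + 1) => uArgs xv i.castSucc) =
      uArgs fun j : Fin (t + 1 + 1) =>
        (xv (Fin.succAbove (Fin.castSucc ⟨1, by omega⟩) j) : FF (t + 1 + 2)) := by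
    funext i
    have hi := i.isLt
    simp only [uArgs, hz, Fin.succAbove, Fin.lt_def, apply_ite Fin.val]
    simp
    grind
  have htail : (fun i : Fin (t + 1) =>
      if i.val = 0 then -(xv 1 - xv (Fin.last (t + 1 + 1))) else uArgs xv i.castSucc) =
      uArgs fun j : Fin (t + 1 + 1) =>
        (xv (Fin.succAbove (Fin.castSucc ⟨0, by omega⟩) j) : FF (t + 1 + 2)) := by
    funext i
    have hi := i.isLt
    simp only [uArgs, hz, Fin.succAbove, Fin.lt_def, apply_ite Fin.val]
    simp
    grind
  have hcycle : (fun i : Fin (t + 1 + 1) =>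
      if i.val = 0 then -(xv 1 - xv 0) else uArgs xv (⟨i.val - 1, by omega⟩ : Fin (t + 1 + 1))) =
      uArgs fun j : Fin (t + 1 + 2) =>
        (xv ⟨(j.val + 1) % (t + 1 + 2), Nat.mod_lt _ (by omega)⟩ : FF (t + 1 + 2)) := by
    funext i
    have hi := i.isLt
    simp only [uArgs, hz]
    rcases hc : i.val with _ | _ | k
    · simp
    · simp
    · have h1 : (t + 1 + 1 - (k + 2) + 1) % (t + 1 + 2) = t + 1 - k := by
        rw [Nat.mod_eq_of_lt] <;> omega
      have h2 : (t + 1 + 1 - (k + 2) + 1 + 1) % (t + 1 + 2) = t + 2 - k := by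
        rw [Nat.mod_eq_of_lt] <;> omega
      grind
  have hflip (a b c d : FF (t + 1 + 2)) : (a - b) / (c - d) = (b - a) / (d - c) := by
    rw [← neg_sub b a, ← neg_sub d c, neg_div_neg_eq]
  rw [hmerge, htail, hcycle, hlast, hinit, hflip _ _ (xv 1) (xv 0)]
  rfl
end

section
/- Let M = (M^m)_{m≥0} be a mould with M^0 = 0 and M^1 = 0 such that swap(M) + C is alternil for some constant mould C. Then the identity ũ(M)^4(−x_1,−x_4,−x_3,−x_2) + coll^4_{2,3}(ũ(M))(−x_1,−x_4,−x_3,−x_2) = ũ(M)^4(−x_1,−x_2,−x_3,−x_4) + coll^4_{2,3}(ũ(M))(−x_1,−x_2,−x_3,−x_4) holds in ℚ(x_1,x_2,x_3,x_4). -/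
open MvPolynomial
open scoped TensorProduct

open MvPolynomial

/-- The swap of a mould: `swap(M)^m(v_1,…,v_m) = M^m(v_m, v_{m-1}-v_m, …, v_1-v_2)`. -/
noncomputable def swapM (M : Mould) : Mould := fun m =>
  MvPolynomial.eval₂ MvPolynomial.C
    (fun i : Fin m =>
      (MvPolynomial.X ⟨m - 1 - i.val, by have := i.isLt; omega⟩ : MvPolynomial (Fin m) ℚ)
        - (if h : i.val = 0 then 0
           else MvPolynomial.X ⟨m - i.val, by have := i.isLt; omega⟩))
    (M m)

open scoped Classical in
/-- Alternality of a mould: `M^0 = 0` and for all `p, q ≥ 1` the sum of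
`M^{p+q}(x_{σ(1)},…,x_{σ(p+q)})` over the `(p,q)`-shuffle permutations vanishes. -/
noncomputable def IsAlternal (M : Mould) : Prop :=
  M 0 = 0 ∧ ∀ p q : ℕ, 1 ≤ p → 1 ≤ q →
    ∑ σ : Equiv.Perm (Fin (p+q)),
      (if ((∀ i j : Fin (p+q), i < j → j.val < p → σ.symm i < σ.symm j) ∧
           (∀ i j : Fin (p+q), i < j → p ≤ i.val → σ.symm i < σ.symm j))
       then MvPolynomial.eval₂ MvPolynomial.C
              (fun i => (X (σ i) : MvPolynomial (Fin (p+q)) ℚ)) (M (p+q))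
       else 0) = 0

/-- The field `ℚ(y_1, y_2, …)` (the variable `X i` stands for `y_{i+1}`). -/
abbrev Kinf : Type := FractionRing (MvPolynomial ℕ ℚ)

noncomputable def yvar (i : ℕ) : Kinf := algebraMap (MvPolynomial ℕ ℚ) Kinf (X i)

/-- A letter: a `ℤ`-linear combination of the letters `x_1, x_2, …`
(the generator `i` stands for `x_{i+1}`). -/
abbrev Letter : Type := ℕ →₀ ℤ

/-- The value of a letter under `x_i ↦ y_i`. -/
noncomputable def letterVal (l : Letter) : Kinf := l.sum fun i n => (n : Kinf) * yvar i

/-- `f(u) = 1/(n_1 y_{i_1} + ⋯ + n_k y_{i_k})` for `u = n_1 x_{i_1} + ⋯ + n_k x_{i_k} ≠ 0`,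
and `f(0) = 0`. -/
noncomputable def collide (l : Letter) : Kinf := (letterVal l)⁻¹

/-- The `ш*` product of two words, as a formal `ℚ(y_1,y_2,…)`-linear combination of words:
`uω ш* vη = u(ω ш* vη) + v(uω ш* η) + f(u-v)·(u(ω ш* η) - v(ω ш* η))`. -/
noncomputable def shMul : List Letter → List Letter → (List Letter →₀ Kinf)
  | [], η => Finsupp.single η 1
  | ω, [] => Finsupp.single ω 1
  | u :: ω, v :: η =>
      Finsupp.mapDomain (List.cons u) (shMul ω (v :: η))
        + Finsupp.mapDomain (List.cons v) (shMul (u :: ω) η)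
        + collide (u - v) • (Finsupp.mapDomain (List.cons u) (shMul ω η)
            - Finsupp.mapDomain (List.cons v) (shMul ω η))
  termination_by ω η => ω.length + η.length

/-- `N^{l(α)}(α)`, evaluated with `y_i := x_i`. -/
noncomputable def wordEval (N : Mould) (α : List Letter) : Kinf :=
  MvPolynomial.eval₂ (Rat.castHom Kinf) (fun j : Fin α.length => letterVal (α.get j))
    (N α.length)

/-- Alternility of a mould: `N^0 = 0` and for all `p, q ≥ 1`,
`Σ_α ⟨(x_1,…,x_p) ш* (x_{p+1},…,x_{p+q}) | α⟩|_{y_i := x_i} · N^{l(α)}(α) = 0`. -/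
noncomputable def IsAlternil (N : Mould) : Prop :=
  N 0 = 0 ∧ ∀ p q : ℕ, 1 ≤ p → 1 ≤ q →
    (shMul ((List.range p).map fun j => Finsupp.single j 1)
           ((List.range q).map fun j => Finsupp.single (p + j) 1)).sum
      (fun α c => c * wordEval N α) = 0

theorem eval₂_ratHom_comp {K L σ : Type*} [Field K] [CharZero K] [CommRing L]
    (φ : L →+* K) (g : ℚ →+* L) (v : σ → L) (p : MvPolynomial σ ℚ) :
    φ (MvPolynomial.eval₂ g v p) = MvPolynomial.eval₂ (Rat.castHom K) (fun i => φ (v i)) p := by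
  rw [MvPolynomial.hom_eval₂, Subsingleton.elim (φ.comp g) (Rat.castHom K)]

theorem letterVal_single (i : ℕ) : letterVal (Finsupp.single i 1) = yvar i := by
  simp [letterVal]

theorem letterVal_single_sub_single (i j : ℕ) :
    letterVal (Finsupp.single i 1 - Finsupp.single j 1) = yvar i - yvar j := by
  rw [← letterVal_single i, ← letterVal_single j]
  exact Finsupp.sum_sub_index fun _ _ _ => by push_cast; ring

theorem yvar_injective : Function.Injective yvar :=
  (IsFractionRing.injective (MvPolynomial ℕ ℚ) Kinf).comp (MvPolynomial.X_injective)

theorem wordEval_pair (N : Mould) (i j : ℕ) :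
    wordEval N [Finsupp.single i 1, Finsupp.single j 1]
      = mEval (Rat.castHom Kinf) N ![yvar i, yvar j] := by
  unfold wordEval mEval
  congr 1
  funext k
  fin_cases k <;> simp [letterVal_single]

theorem wordEval_triple (N : Mould) (i j k : ℕ) :
    wordEval N [Finsupp.single i 1, Finsupp.single j 1, Finsupp.single k 1]
      = mEval (Rat.castHom Kinf) N ![yvar i, yvar j, yvar k] := by
  unfold wordEval mEval
  congr 1
  funext k
  fin_cases k <;> simp [letterVal_single]

/-- The alternility relation for `(p, q) = (1, 2)`, in the variables `y_1, y_2, y_3`. -/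
theorem IsAlternil.one_two_yvar {N : Mould} (hN : IsAlternil N) :
    mEval (Rat.castHom Kinf) N ![yvar 0, yvar 1, yvar 2]
      + mEval (Rat.castHom Kinf) N ![yvar 1, yvar 0, yvar 2]
      + mEval (Rat.castHom Kinf) N ![yvar 1, yvar 2, yvar 0]
      + (mEval (Rat.castHom Kinf) N ![yvar 1, yvar 0]
          - mEval (Rat.castHom Kinf) N ![yvar 1, yvar 2]) / (yvar 0 - yvar 2)
      + (mEval (Rat.castHom Kinf) N ![yvar 0, yvar 2]
          - mEval (Rat.castHom Kinf) N ![yvar 1, yvar 2]) / (yvar 0 - yvar 1) = 0 := by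
  have h := hN.2 1 2 le_rfl one_le_two
  change Finsupp.linearCombination Kinf (wordEval N) _ = 0 at h
  simp only [List.range_succ, List.range_zero, List.nil_append, List.map_cons, List.map_nil,
    List.cons_append, shMul, Finsupp.mapDomain_add, Finsupp.mapDomain_sub, Finsupp.mapDomain_smul,
    Finsupp.mapDomain_single, map_add, map_sub, map_smul, Finsupp.linearCombination_single,
    smul_eq_mul, add_zero, Nat.reduceAdd, wordEval_pair, wordEval_triple, collide,
    letterVal_single_sub_single] at h
  linear_combination h

/-- The alternility relation for `(p, q) = (1, 2)` at three points of a field. -/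
theorem IsAlternil.one_two {N : Mould} (hN : IsAlternil N) {K : Type} [Field K] [CharZero K]
    {x y z : K} (hxy : x ≠ y) (hxz : x ≠ z) :
    mEval (Rat.castHom K) N ![x, y, z] + mEval (Rat.castHom K) N ![y, x, z]
      + mEval (Rat.castHom K) N ![y, z, x]
      + (mEval (Rat.castHom K) N ![y, x] - mEval (Rat.castHom K) N ![y, z]) / (x - z)
      + (mEval (Rat.castHom K) N ![x, z] - mEval (Rat.castHom K) N ![y, z]) / (x - y) = 0 := by
  let E {m : ℕ} (w : Fin m → ℕ) : MvPolynomial ℕ ℚ :=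
    MvPolynomial.eval₂ MvPolynomial.C (fun i => X (w i)) (N m)
  have hE {L : Type} [Field L] [CharZero L] (φ : MvPolynomial ℕ ℚ →+* L) {m : ℕ}
      (w : Fin m → ℕ) (v : Fin m → L) (hv : ∀ i, φ (X (w i)) = v i) :
      φ (E w) = mEval (Rat.castHom L) N v := by
    rw [mEval, ← funext hv]
    exact eval₂_ratHom_comp φ _ _ _
  have key : (E ![0, 1, 2] + E ![1, 0, 2] + E ![1, 2, 0]) * ((X 0 - X 2) * (X 0 - X 1))
      + (E ![1, 0] - E ![1, 2]) * (X 0 - X 1) + (E ![0, 2] - E ![1, 2]) * (X 0 - X 2) = 0 := by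
    apply IsFractionRing.injective (MvPolynomial ℕ ℚ) Kinf
    have h := hN.one_two_yvar
    have h01 : yvar 0 - yvar 1 ≠ 0 := sub_ne_zero.2 (yvar_injective.ne (by decide))
    have h02 : yvar 0 - yvar 2 ≠ 0 := sub_ne_zero.2 (yvar_injective.ne (by decide))
    have e2 (i j : ℕ) := hE (algebraMap (MvPolynomial ℕ ℚ) Kinf) ![i, j] ![yvar i, yvar j]
      (by intro k; fin_cases k <;> rfl)
    have e3 (i j k : ℕ) := hE (algebraMap (MvPolynomial ℕ ℚ) Kinf) ![i, j, k]
      ![yvar i, yvar j, yvar k] (by intro k; fin_cases k <;> rfl)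
    have eX (i : ℕ) : algebraMap (MvPolynomial ℕ ℚ) Kinf (X i) = yvar i := rfl
    simp only [map_add, map_sub, map_mul, map_zero, e2, e3, eX]
    field_simp at h
    linear_combination h
  let p : ℕ → K := fun i => if i = 0 then x else if i = 1 then y else z
  let φ : MvPolynomial ℕ ℚ →+* K := MvPolynomial.eval₂Hom (Rat.castHom K) p
  have eX (i : ℕ) : φ (X i) = p i := MvPolynomial.eval₂Hom_X' _ _ _
  have e2 (i j : ℕ) := hE φ ![i, j] ![p i, p j] (by intro k; fin_cases k <;> exact eX _)
  have e3 (i j k : ℕ) := hE φ ![i, j, k] ![p i, p j, p k]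
    (by intro k; fin_cases k <;> exact eX _)
  have h := congrArg φ key
  simp only [map_add, map_sub, map_mul, map_zero, e2, e3, eX] at h
  have p0 : p 0 = x := rfl
  have p1 : p 1 = y := rfl
  have p2 : p 2 = z := rfl
  rw [p0, p1, p2] at h
  have h01 := sub_ne_zero.2 hxy
  have h02 := sub_ne_zero.2 hxz
  field_simp
  linear_combination h

/-- Difference of the `(1, 2)` alternility relations with the extreme points exchanged. -/
theorem IsAlternil.reversal {N : Mould} (hN : IsAlternil N) {K : Type} [Field K] [CharZero K]
    {a b c : K} (hab : a ≠ b) (hac : a ≠ c) (hcb : c ≠ b) :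
    mEval (Rat.castHom K) N ![c, b, a]
      + (mEval (Rat.castHom K) N ![c, a] - mEval (Rat.castHom K) N ![b, a]) / (c - b)
    = mEval (Rat.castHom K) N ![a, b, c]
      + (mEval (Rat.castHom K) N ![a, c] - mEval (Rat.castHom K) N ![b, c]) / (a - b) := by
  have hsymm : (mEval (Rat.castHom K) N ![b, a] - mEval (Rat.castHom K) N ![b, c]) / (a - c)
      = (mEval (Rat.castHom K) N ![b, c] - mEval (Rat.castHom K) N ![b, a]) / (c - a) := by
    rw [← neg_div_neg_eq, neg_sub, neg_sub]
  linear_combination hN.one_two hcb hac.symm - hN.one_two hab hac + hsymm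

theorem mEval_swapM_add_C {K : Type} [Field K] [CharZero K] (M : Mould) (c : ℕ → ℚ) {m : ℕ}
    (v : Fin (m + 1) → K) :
    mEval (Rat.castHom K) (fun m => swapM M m + MvPolynomial.C (c m)) (fun i => v i.succ - v 0)
      = uEval (Rat.castHom K) M v + c m := by
  rw [uEval, mEval, MvPolynomial.eval₂_add, MvPolynomial.eval₂_C, eq_ratCast]
  congr 1
  refine (eval₂_ratHom_comp (MvPolynomial.eval₂Hom (Rat.castHom K) _) _ _ _).trans ?_
  unfold mEval
  congr 1
  funext j
  have hj := j.isLt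
  by_cases h : j.val = 0
  · simp only [h, dif_pos, sub_zero, MvPolynomial.coe_eval₂Hom,
      MvPolynomial.eval₂_X]
    congr 2
    ext
    simp only [Fin.val_succ, Fin.val_last]
    omega
  · simp only [h, dif_neg, not_false_eq_true, map_sub, MvPolynomial.coe_eval₂Hom,
      MvPolynomial.eval₂_X, sub_sub_sub_cancel_right]
    congr 2
    ext
    simp only [Fin.val_succ]
    omega

theorem xv_injective {n : ℕ} : Function.Injective (xv (n := n)) :=
  (IsFractionRing.injective (MvPolynomial (Fin n) ℚ) (FF n)).comp (MvPolynomial.X_injective)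

set_option maxHeartbeats 1000000 in
/-- Let `M` be a mould with `M^0 = 0`, `M^1 = 0` such that
`swap(M) + C` is alternil for some constant mould `C`.  Then
`ũ(M)^4(-x_1,-x_4,-x_3,-x_2) + coll^4_{2,3}(ũ(M))(-x_1,-x_4,-x_3,-x_2)
 = ũ(M)^4(-x_1,-x_2,-x_3,-x_4) + coll^4_{2,3}(ũ(M))(-x_1,-x_2,-x_3,-x_4)`
in `ℚ(x_1,x_2,x_3,x_4)`. -/
theorem alternil_coll_identity (M : Mould) (h0 : M 0 = 0) (h1 : M 1 = 0)
    (hil : ∃ c : ℕ → ℚ, IsAlternil (fun m => swapM M m + MvPolynomial.C (c m))) :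
    uEval (Rat.castHom (FF 4)) M ![-xv 0, -xv 3, -xv 2, -xv 1]
        + collUEval (Rat.castHom (FF 4)) M 1 ![-xv 0, -xv 3, -xv 2, -xv 1]
      = uEval (Rat.castHom (FF 4)) M ![-xv 0, -xv 1, -xv 2, -xv 3]
        + collUEval (Rat.castHom (FF 4)) M 1 ![-xv 0, -xv 1, -xv 2, -xv 3] := by
  obtain ⟨c, hN⟩ := hil
  have ne {i j : Fin 4} (h : i ≠ j) : -xv i - -xv 0 ≠ -xv j - -xv (0 : Fin 4) := by
    intro e
    exact h (xv_injective (neg_injective (sub_left_injective e)))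
  have h := hN.reversal (ne (i := 1) (j := 2) (by decide)) (ne (i := 1) (j := 3) (by decide))
    (ne (i := 3) (j := 2) (by decide))
  have u3 (p q r s : FF 4) : mEval (Rat.castHom (FF 4)) _ ![q - p, r - p, s - p] = _ :=
    (congrArg _ (by funext i; fin_cases i <;> rfl)).trans (mEval_swapM_add_C M c ![p, q, r, s])
  have u2 (p q r : FF 4) : mEval (Rat.castHom (FF 4)) _ ![q - p, r - p] = _ :=
    (congrArg _ (by funext i; fin_cases i <;> rfl)).trans (mEval_swapM_add_C M c ![p, q, r])
  rw [u3, u3, u2, u2, u2, u2, add_sub_add_right_eq_sub, add_sub_add_right_eq_sub,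
    sub_sub_sub_cancel_right, sub_sub_sub_cancel_right] at h
  have hc (p q r s : FF 4) : collUEval (Rat.castHom (FF 4)) M 1 ![p, q, r, s]
      = (uEval (Rat.castHom (FF 4)) M ![p, q, s] - uEval (Rat.castHom (FF 4)) M ![p, r, s])
        / (q - r) := by
    unfold collUEval
    congr 3 <;> (funext i; fin_cases i <;> rfl)
  rw [hc, hc]
  linear_combination h
end
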